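/- For d ≥ 3, the quantity 2d · G_O^{(d)}(0, 0) is decreasing in d, where G_O^{(d)} is the Green's function of the simple random walk on the d-dimensional discrete orthant O = ℕ₀^d at the origin; equivalently, the map d ↦ ∫_0^∞ e^{−x} ( I₁(x/d) + I₀(x/d) )^d dx is decreasing for d ≥ 3, where I₀, I₁ are the modified Bessel functions of the first kind of orders 0 and 1. -/

import Mathlib

open scoped ENNReal
open Filter

noncomputable section

variable {V : Type*}

/-- Total conductance (weight) `π(x) = Σ_y c(x,y)` at a vertex `x`. -/
def piW (c : V → V → ℝ≥0∞) (x : V) : ℝ≥0∞ := ∑' y, c x y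

/-- One-step transition probability `c(x,y)/π(x)` of the random walk with conductances `c`. -/
def step (c : V → V → ℝ≥0∞) (x y : V) : ℝ≥0∞ := c x y / piW c x

/-- `n`-step transition probability of the random walk with conductances `c`. -/
def stepN [DecidableEq V] (c : V → V → ℝ≥0∞) : ℕ → V → V → ℝ≥0∞
  | 0, x, y => if x = y then 1 else 0
  | n + 1, x, y => ∑' z, stepN c n x z * step c z y

/-- Green's function `G(x,y) = π(y)⁻¹ Σ_n p_n(x,y)` of the walk with conductances `c`. -/
def green [DecidableEq V] (c : V → V → ℝ≥0∞) (x y : V) : ℝ≥0∞ :=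
  (piW c y)⁻¹ * ∑' n, stepN c n x y

/-- Nearest-neighbour adjacency on `ℤ^d`. -/
def latAdj {d : ℕ} (x y : Fin d → ℤ) : Prop := (∑ i, (x i - y i).natAbs) = 1

instance {d : ℕ} (x y : Fin d → ℤ) : Decidable (latAdj x y) := by
  unfold latAdj; infer_instance

/-- Unit conductances on `ℤ^d`. -/
def cZ (d : ℕ) (x y : Fin d → ℤ) : ℝ≥0∞ := if latAdj x y then 1 else 0

/-- Green's function of the simple random walk on `ℤ^d`. -/
def g (d : ℕ) : (Fin d → ℤ) → (Fin d → ℤ) → ℝ≥0∞ := green (cZ d)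

/-- Membership in `U_m = ℕ₀^m × ℤ^{d-m}`: the first `m` coordinates are nonnegative. -/
def memU (m : ℕ) {d : ℕ} (x : Fin d → ℤ) : Prop := ∀ i : Fin d, (i : ℕ) < m → 0 ≤ x i

instance (m : ℕ) {d : ℕ} (x : Fin d → ℤ) : Decidable (memU m x) := by
  unfold memU; infer_instance

/-- Unit conductances on the subgraph `U_m` of `ℤ^d`. -/
def cU (d m : ℕ) (x y : Fin d → ℤ) : ℝ≥0∞ :=
  if memU m x ∧ memU m y ∧ latAdj x y then 1 else 0

/-- Green's function `G_m` of the simple random walk on `U_m = ℕ₀^m × ℤ^{d-m}`. -/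
def Gm (d m : ℕ) : (Fin d → ℤ) → (Fin d → ℤ) → ℝ≥0∞ := green (cU d m)

/-- Reflection in the first coordinate: `ȳ = (-y₁, y₂, …, y_d)`. -/
def reflFirst {d : ℕ} (y : Fin d → ℤ) : Fin d → ℤ := fun i => if (i : ℕ) = 0 then -y i else y i

/-- The first standard basis vector of `ℤ^d`. -/
def e1 (d : ℕ) : Fin d → ℤ := fun i => if (i : ℕ) = 0 then 1 else 0


open MeasureTheory Polynomial Real

/-- The probability measure with density `(1 + cos θ) / π` on `(0, π)`; the image under `cos` is the
spectral measure at the origin of the walk on `ℕ₀` that is reflected at `-1/2`. -/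
def angleMeasure : Measure ℝ :=
  (volume.restrict (Set.Ioo 0 π)).withDensity fun θ => ENNReal.ofReal ((1 + cos θ) / π)

/-- The Chebyshev polynomials of the third kind `U_k - U_{k-1}`, evaluated at `cos θ`. -/
def chebV (k : ℤ) (θ : ℝ) : ℝ := (Chebyshev.U ℝ k - Chebyshev.U ℝ (k - 1)).eval (cos θ)

lemma chebV_add_one_add_sub_one (k : ℤ) (θ : ℝ) :
    chebV (k + 1) θ + chebV (k - 1) θ = 2 * cos θ * chebV k θ := by
  have h1 := Chebyshev.U_sub_one ℝ k
  have h2 := Chebyshev.U_sub_one ℝ (k - 1)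
  simp only [chebV, h2, sub_add_cancel, add_sub_cancel_right]
  have h1' := congrArg (eval (cos θ)) h1
  simp at h1' ⊢
  linear_combination h1'

lemma chebV_zero (θ : ℝ) : chebV 0 θ = 1 := by simp [chebV]

lemma chebV_neg_one (θ : ℝ) : chebV (-1) θ = 1 := by
  simp [chebV, Chebyshev.U_neg_one]

lemma one_add_cos_mul_chebV (k : ℤ) (θ : ℝ) :
    (1 + cos θ) * chebV k θ = cos (k * θ) + cos ((k + 1 : ℤ) * θ) := by
  have h1 := congrArg (eval (cos θ)) (Chebyshev.T_eq_U_sub_X_mul_U ℝ k)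
  have h2 := congrArg (eval (cos θ)) (Chebyshev.T_eq_U_sub_X_mul_U ℝ (k + 1))
  have h3 := congrArg (eval (cos θ)) (Chebyshev.U_sub_one ℝ k)
  rw [Chebyshev.T_real_cos] at h1 h2
  rw [h1, h2]
  simp [chebV] at h3 ⊢
  linear_combination (-1 : ℝ) * h3

lemma continuous_chebV (k : ℤ) : Continuous (chebV k) := by
  unfold chebV; fun_prop

lemma abs_chebV_le (k : ℤ) : ∃ C, ∀ θ, |chebV k θ| ≤ C := by
  obtain ⟨C, hC⟩ := (isCompact_Icc (a := (-1 : ℝ)) (b := 1)).exists_bound_of_continuousOn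
    (Chebyshev.U ℝ k - Chebyshev.U ℝ (k - 1)).continuous.continuousOn
  exact ⟨C, fun θ => hC _ (cos_mem_Icc θ)⟩

lemma angle_density_nonneg (θ : ℝ) : 0 ≤ (1 + cos θ) / π :=
  div_nonneg (by linarith [neg_one_le_cos θ]) pi_pos.le

lemma integral_angleMeasure (f : ℝ → ℝ) :
    ∫ θ, f θ ∂angleMeasure = ∫ θ in (0)..π, (1 + cos θ) / π * f θ := by
  rw [angleMeasure, integral_withDensity_eq_integral_toReal_smul (by fun_prop) (by simp),
    intervalIntegral.integral_of_le pi_pos.le, ← integral_Ioc_eq_integral_Ioo]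
  simp only [ENNReal.toReal_ofReal (angle_density_nonneg _), smul_eq_mul]

lemma integral_cos_int_mul (k : ℤ) :
    ∫ θ in (0)..π, cos (k * θ) = if k = 0 then π else 0 := by
  split_ifs with h
  · simp [h]
  · rw [intervalIntegral.integral_comp_mul_left (fun x => cos x) (Int.cast_ne_zero.mpr h)]
    simp [sin_int_mul_pi]

lemma integral_chebV (k : ℤ) :
    ∫ θ, chebV k θ ∂angleMeasure = (if k = 0 then 1 else 0) + if k + 1 = 0 then 1 else 0 := by
  have h : ∀ θ, (1 + cos θ) / π * chebV k θ = (cos (k * θ) + cos ((k + 1 : ℤ) * θ)) * π⁻¹ := by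
    intro θ
    rw [← one_add_cos_mul_chebV]; ring
  have hi : ∀ m : ℤ, IntervalIntegrable (fun θ => cos (m * θ)) volume 0 π := fun m =>
    (by fun_prop : Continuous fun θ : ℝ => cos (m * θ)).intervalIntegrable _ _
  rw [integral_angleMeasure, intervalIntegral.integral_congr (fun θ _ => h θ),
    intervalIntegral.integral_mul_const, intervalIntegral.integral_add (hi _) (hi _),
    integral_cos_int_mul, integral_cos_int_mul]
  split_ifs <;> first | omega | simp [pi_ne_zero]

instance : IsProbabilityMeasure angleMeasure := by
  have : IsFiniteMeasure angleMeasure :=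
    isFiniteMeasure_withDensity_ofReal (HasFiniteIntegral.restrict_of_bounded (2 / π) (by simp)
      (ae_of_all _ fun θ => by
        rw [norm_of_nonneg (angle_density_nonneg θ)]
        gcongr; linarith [cos_le_one θ]))
  have h := integral_chebV 0
  simp only [chebV_zero] at h
  refine ⟨?_⟩
  simp [Measure.real] at h
  exact (ENNReal.toReal_eq_one_iff _).mp h

lemma ae_angleMeasure_abs_cos_lt_one : ∀ᵐ θ ∂angleMeasure, |cos θ| < 1 := by
  refine (withDensity_absolutelyContinuous _ _).ae_le ?_
  filter_upwards [ae_restrict_mem measurableSet_Ioo] with θ hθ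
  have hs := sin_pos_of_pos_of_lt_pi hθ.1 hθ.2
  rw [abs_lt]
  constructor <;> nlinarith [sin_sq_add_cos_sq θ, neg_one_le_cos θ, cos_le_one θ]

lemma integrable_one_sub_cos_rpow {s : ℝ} (hs0 : 0 ≤ s) (hs : s < 1 / 2) :
    Integrable (fun θ => (1 - cos θ) ^ (-s)) angleMeasure := by
  rw [angleMeasure, integrable_withDensity_iff_integrable_smul' (by fun_prop) (by simp)]
  simp only [ENNReal.toReal_ofReal (angle_density_nonneg _), smul_eq_mul]
  have hint : Integrable (fun θ : ℝ => 2 / π * ((2 / π ^ 2) ^ (-s) * θ ^ (-(2 * s))))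
      (volume.restrict (Set.Ioo 0 π)) := by
    have h := intervalIntegral.intervalIntegrable_rpow' (a := 0) (b := π) (r := -(2 * s))
      (by linarith)
    rw [intervalIntegrable_iff_integrableOn_Ioo_of_le pi_pos.le] at h
    exact (h.integrable.const_mul _).const_mul _
  refine hint.mono' (Measurable.aestronglyMeasurable (by fun_prop)) ?_
  filter_upwards [ae_restrict_mem measurableSet_Ioo] with θ hθ
  have hcos : 2 / π ^ 2 * θ ^ 2 ≤ 1 - cos θ := by
    linarith [cos_le_one_sub_mul_cos_sq (x := θ) (by rw [abs_of_pos hθ.1]; exact hθ.2.le)]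
  have hpos : 0 < 2 / π ^ 2 * θ ^ 2 := by have := hθ.1; positivity
  rw [norm_mul, norm_of_nonneg (angle_density_nonneg θ),
    norm_of_nonneg (rpow_nonneg (hpos.le.trans hcos) _)]
  refine mul_le_mul (by gcongr; linarith [cos_le_one θ]) ?_
    (rpow_nonneg (hpos.le.trans hcos) _) (by positivity)
  calc (1 - cos θ) ^ (-s) ≤ (2 / π ^ 2 * θ ^ 2) ^ (-s) :=
        rpow_le_rpow_of_nonpos hpos hcos (by linarith)
    _ = (2 / π ^ 2) ^ (-s) * θ ^ (-(2 * s)) := by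
        rw [mul_rpow (by positivity) (by positivity), ← rpow_natCast θ 2, ← rpow_mul hθ.1.le]
        norm_num

/-- The product of `d` copies of `angleMeasure`. -/
def anglePi (d : ℕ) : Measure (Fin d → ℝ) := Measure.pi fun _ => angleMeasure

instance (d : ℕ) : IsProbabilityMeasure (anglePi d) := by unfold anglePi; infer_instance

/-- The average of the cosines of `d` angles. -/
def cosAvg {d : ℕ} (θ : Fin d → ℝ) : ℝ := (∑ i, cos (θ i)) / d

@[fun_prop]
lemma continuous_cosAvg {d : ℕ} : Continuous (cosAvg (d := d)) := by
  unfold cosAvg; fun_prop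

lemma abs_cosAvg_le_one {d : ℕ} (θ : Fin d → ℝ) : |cosAvg θ| ≤ 1 := by
  rw [cosAvg, abs_div, Nat.abs_cast]
  refine div_le_one_of_le₀ ((Finset.abs_sum_le_sum_abs _ _).trans ?_) (Nat.cast_nonneg d)
  exact (Finset.sum_le_card_nsmul _ _ 1 fun i _ => abs_cos_le_one _).trans (by simp)

lemma ae_anglePi_abs_cos_lt_one (d : ℕ) : ∀ᵐ θ ∂anglePi d, ∀ i, |cos (θ i)| < 1 :=
  ae_all_iff.mpr fun i =>
    (Measure.quasiMeasurePreserving_eval (fun _ => angleMeasure) i).ae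
      ae_angleMeasure_abs_cos_lt_one

lemma abs_cosAvg_lt_one {d : ℕ} [NeZero d] {θ : Fin d → ℝ} (h : ∀ i, |cos (θ i)| < 1) :
    |cosAvg θ| < 1 := by
  have hd : (0 : ℝ) < d := by exact_mod_cast Nat.pos_of_neZero d
  rw [cosAvg, abs_div, Nat.abs_cast, div_lt_one hd]
  refine (Finset.abs_sum_le_sum_abs _ _).trans_lt ?_
  calc ∑ i, |cos (θ i)| < ∑ _i : Fin d, (1 : ℝ) :=
        Finset.sum_lt_sum_of_nonempty Finset.univ_nonempty fun i _ => h i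
    _ = d := by simp

lemma one_sub_cosAvg {d : ℕ} [NeZero d] (θ : Fin d → ℝ) :
    1 - cosAvg θ = (∑ i, (1 - cos (θ i))) / d := by
  have hd : (d : ℝ) ≠ 0 := by exact_mod_cast NeZero.ne d
  rw [cosAvg, Finset.sum_sub_distrib, sub_div]
  simp [hd]

lemma integrable_inv_one_sub_cosAvg {d : ℕ} (hd : 3 ≤ d) :
    Integrable (fun θ => (1 - cosAvg θ)⁻¹) (anglePi d) := by
  have : NeZero d := ⟨by omega⟩
  have hd3 : (3 : ℝ) ≤ d := by exact_mod_cast hd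
  have hd0 : (0 : ℝ) < d := by linarith
  have hint : Integrable (fun θ : Fin d → ℝ => ∏ i, (1 - cos (θ i)) ^ (-(d : ℝ)⁻¹)) (anglePi d) :=
    Integrable.fintype_prod fun _ => integrable_one_sub_cos_rpow (by positivity) (by
      rw [inv_lt_comm₀ hd0 (by norm_num)]; norm_num; linarith)
  refine hint.mono' (Measurable.aestronglyMeasurable (by fun_prop)) ?_
  filter_upwards [ae_anglePi_abs_cos_lt_one d] with θ hθ
  have hpos : ∀ i, 0 < 1 - cos (θ i) := fun i => by linarith [(abs_lt.mp (hθ i)).2]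
  have hamgm := geom_mean_le_arith_mean_weighted Finset.univ (fun _ : Fin d => (d : ℝ)⁻¹)
    (fun i => 1 - cos (θ i)) (fun _ _ => by positivity) (by simp [hd0.ne'])
    (fun i _ => (hpos i).le)
  rw [← Finset.mul_sum, ← div_eq_inv_mul, ← one_sub_cosAvg] at hamgm
  have hprod : 0 < ∏ i, (1 - cos (θ i)) ^ (d : ℝ)⁻¹ :=
    Finset.prod_pos fun i _ => rpow_pos_of_pos (hpos i) _
  rw [norm_inv, norm_of_nonneg (hprod.le.trans hamgm),
    Finset.prod_congr rfl fun i _ => rpow_neg (hpos i).le _, Finset.prod_inv_distrib]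
  gcongr

/-- The function `∏ i, V_{y i}(cos θ_i)`, a generalized eigenfunction of the reflected walk. -/
def chebProd {d : ℕ} (y : Fin d → ℤ) (θ : Fin d → ℝ) : ℝ := ∏ i, chebV (y i) (θ i)

@[fun_prop]
lemma continuous_chebProd {d : ℕ} (y : Fin d → ℤ) : Continuous (chebProd y) :=
  continuous_finsetProd _ fun i _ => (continuous_chebV _).comp (continuous_apply i)

lemma abs_chebProd_le {d : ℕ} (y : Fin d → ℤ) : ∃ C, ∀ θ, |chebProd y θ| ≤ C := by
  choose C hC using abs_chebV_le
  refine ⟨∏ i, C (y i), fun θ => ?_⟩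
  rw [chebProd, Finset.abs_prod]
  exact Finset.prod_le_prod (fun _ _ => abs_nonneg _) fun i _ => hC _ _

lemma chebProd_zero {d : ℕ} (θ : Fin d → ℝ) : chebProd 0 θ = 1 := by
  simp [chebProd, chebV_zero]

/-- The neighbour of `y` in direction `±e_i`. -/
def nbr {d : ℕ} (y : Fin d → ℤ) (p : Fin d × ℤˣ) : Fin d → ℤ :=
  Function.update y p.1 (y p.1 + p.2)

lemma chebProd_update {d : ℕ} (y : Fin d → ℤ) (i : Fin d) (k : ℤ) (θ : Fin d → ℝ) :
    chebProd (Function.update y i k) θ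
      = chebV k (θ i) * ∏ j ∈ Finset.univ.erase i, chebV (y j) (θ j) := by
  rw [chebProd, ← Finset.mul_prod_erase _ _ (Finset.mem_univ i), Function.update_self]
  congr 1
  refine Finset.prod_congr rfl fun j hj => ?_
  rw [Function.update_of_ne (Finset.ne_of_mem_erase hj)]

lemma sum_chebProd_nbr {d : ℕ} [NeZero d] (y : Fin d → ℤ) (θ : Fin d → ℝ) :
    ∑ p, chebProd (nbr y p) θ = 2 * d * (chebProd y θ * cosAvg θ) := by
  have hd : (d : ℝ) ≠ 0 := by exact_mod_cast NeZero.ne d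
  have h : ∀ i, ∑ u : ℤˣ, chebProd (nbr y (i, u)) θ = 2 * cos (θ i) * chebProd y θ := by
    intro i
    have hy := chebProd_update y i (y i) θ
    rw [Function.update_eq_self] at hy
    simp only [nbr, chebProd_update, UnitsInt.univ, hy]
    rw [← Finset.sum_mul, Finset.sum_pair (by decide), ← mul_assoc,
      ← chebV_add_one_add_sub_one]
    simp [sub_eq_add_neg]
  rw [Fintype.sum_prod_type]
  simp only [h]
  rw [← Finset.sum_mul, ← Finset.mul_sum, cosAvg]
  field_simp

lemma chebProd_nbr_of_not_memU {d : ℕ} {y : Fin d → ℤ} (hy : memU d y) {p : Fin d × ℤˣ}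
    (hp : ¬ memU d (nbr y p)) : chebProd (nbr y p) = chebProd y := by
  obtain ⟨i, u⟩ := p
  have hneg : y i + u < 0 := by
    by_contra! hle
    refine hp fun j hj => ?_
    by_cases hji : j = i
    · subst hji; simpa [nbr] using hle
    · simpa [nbr, hji] using hy j hj
  have hi : y i = 0 ∧ (u : ℤ) = -1 := by
    have := hy i i.2
    rcases Int.units_eq_one_or u with rfl | rfl <;> simp at hneg ⊢ <;> omega
  funext θ
  have hy' := chebProd_update y i (y i) θ
  rw [Function.update_eq_self] at hy'
  rw [nbr, chebProd_update, hy', hi.1, hi.2, zero_add, chebV_zero, chebV_neg_one]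

/-- The spectral moments `∫ ∏ i, V_{y i}(cos θ_i) * (cosAvg θ) ^ n`. -/
def specMoment {d : ℕ} (n : ℕ) (y : Fin d → ℤ) : ℝ :=
  ∫ θ, chebProd y θ * cosAvg θ ^ n ∂anglePi d

lemma integrable_chebProd_mul_cosAvg_pow {d : ℕ} (n : ℕ) (y : Fin d → ℤ) :
    Integrable (fun θ => chebProd y θ * cosAvg θ ^ n) (anglePi d) := by
  obtain ⟨C, hC⟩ := abs_chebProd_le y
  refine .of_bound (Continuous.aestronglyMeasurable (by fun_prop)) C (ae_of_all _ fun θ => ?_)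
  rw [norm_mul, norm_pow]
  exact (mul_le_of_le_one_right (norm_nonneg _)
    (pow_le_one₀ (norm_nonneg _) (abs_cosAvg_le_one θ))).trans (hC θ)

lemma specMoment_succ {d : ℕ} [NeZero d] (n : ℕ) (y : Fin d → ℤ) :
    2 * d * specMoment (n + 1) y = ∑ p, specMoment n (nbr y p) := by
  simp only [specMoment]
  rw [← integral_finsetSum _ fun p _ => integrable_chebProd_mul_cosAvg_pow n _,
    ← integral_const_mul]
  congr 1 with θ
  rw [← Finset.sum_mul, sum_chebProd_nbr]
  ring

lemma specMoment_zero {d : ℕ} (y : Fin d → ℤ) :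
    specMoment 0 y = ∏ i, ((if y i = 0 then 1 else 0) + if y i + 1 = 0 then 1 else 0 : ℝ) := by
  simp only [specMoment, pow_zero, mul_one, chebProd, anglePi]
  rw [integral_fintype_prod_eq_prod (fun i => chebV (y i))]
  simp only [integral_chebV]

lemma specMoment_zero_of_memU {d : ℕ} {y : Fin d → ℤ} (hy : memU d y) :
    specMoment 0 y = if 0 = y then 1 else 0 := by
  have h : ∀ i, y i + 1 ≠ 0 := fun i => by have := hy i i.2; omega
  simp only [specMoment_zero, h, if_false, add_zero, Fintype.prod_ite_zero]
  simp [funext_iff, eq_comm]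

lemma specMoment_nonneg {d : ℕ} [NeZero d] (n : ℕ) (y : Fin d → ℤ) : 0 ≤ specMoment n y := by
  induction n generalizing y with
  | zero =>
    rw [specMoment_zero]
    exact Finset.prod_nonneg fun i _ => by positivity
  | succ n ih =>
    have hd : (0 : ℝ) < 2 * d := by have := Nat.pos_of_neZero d; positivity
    refine nonneg_of_mul_nonneg_right ?_ hd
    rw [specMoment_succ]
    exact Finset.sum_nonneg fun p _ => ih _

lemma hasSum_specMoment {d : ℕ} (hd : 3 ≤ d) (y : Fin d → ℤ) :
    HasSum (fun n => specMoment n y) (∫ θ, chebProd y θ * (1 - cosAvg θ)⁻¹ ∂anglePi d) := by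
  have : NeZero d := ⟨by omega⟩
  rw [hasSum_iff_tendsto_nat_of_nonneg fun n => specMoment_nonneg n y]
  obtain ⟨C, hC⟩ := abs_chebProd_le y
  simp only [specMoment, ← integral_finsetSum _ fun n _ => integrable_chebProd_mul_cosAvg_pow n y]
  refine tendsto_integral_of_dominated_convergence
    (fun θ => C * (2 * (1 - cosAvg θ)⁻¹)) (fun N => Continuous.aestronglyMeasurable (by fun_prop))
    (((integrable_inv_one_sub_cosAvg hd).const_mul _).const_mul _) (fun N => ?_) ?_
  · filter_upwards [ae_anglePi_abs_cos_lt_one d] with θ hθ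
    have h := abs_lt.mp (abs_cosAvg_lt_one hθ)
    have hpow : |cosAvg θ ^ N| ≤ 1 := by
      rw [abs_pow]; exact pow_le_one₀ (abs_nonneg _) (abs_cosAvg_le_one θ)
    rw [← Finset.mul_sum, norm_mul, geom_sum_eq h.2.ne, ← neg_div_neg_eq, norm_div, neg_sub,
      neg_sub, norm_of_nonneg (by linarith : 0 ≤ 1 - cosAvg θ), div_eq_mul_inv]
    refine mul_le_mul (hC θ) ?_ (by positivity [h.2]) ((abs_nonneg _).trans (hC θ))
    refine mul_le_mul_of_nonneg_right ?_ (inv_nonneg.mpr (by linarith))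
    rw [norm_eq_abs, abs_le]
    constructor <;> linarith [(abs_le.mp hpow).1, (abs_le.mp hpow).2]
  · filter_upwards [ae_anglePi_abs_cos_lt_one d] with θ hθ
    simp only [← Finset.mul_sum]
    exact ((hasSum_geometric_of_abs_lt_one (abs_cosAvg_lt_one hθ)).tendsto_sum_nat).const_mul _


lemma memU_zero {d : ℕ} : memU d (0 : Fin d → ℤ) := fun _ _ => le_rfl

lemma nbr_injective {d : ℕ} (y : Fin d → ℤ) : Function.Injective (nbr y) := by
  rintro ⟨i, u⟩ ⟨j, v⟩ h
  have hi := congrFun h i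
  by_cases hij : i = j
  · subst hij
    simpa [nbr, Units.ext_iff] using hi
  · simp [nbr, hij] at hi

lemma latAdj_iff_mem_range_nbr {d : ℕ} (z y : Fin d → ℤ) :
    latAdj z y ↔ z ∈ Set.range (nbr y) := by
  constructor
  · intro h
    rw [latAdj] at h
    obtain ⟨i, -, hi⟩ := Finset.exists_ne_zero_of_sum_ne_zero (h.trans_ne one_ne_zero)
    have hsum := Finset.add_sum_erase Finset.univ (fun j => (z j - y j).natAbs) (Finset.mem_univ i)
    have hrest : ∑ j ∈ Finset.univ.erase i, (z j - y j).natAbs = 0 := by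
      omega
    rw [Finset.sum_eq_zero_iff] at hrest
    have hz : ∀ u : ℤˣ, z i - y i = u → z = nbr y (i, u) := fun u hu => by
      funext j
      by_cases hji : j = i
      · subst hji; simp [nbr, ← hu]
      · have := hrest j (by simp [hji])
        simp only [nbr, ne_eq, hji, not_false_eq_true, Function.update_of_ne]
        omega
    have hone : (z i - y i).natAbs = 1 := by
      have hle := Finset.single_le_sum (f := fun j => (z j - y j).natAbs)
        (fun _ _ => Nat.zero_le _) (Finset.mem_univ i)
      omega
    obtain ⟨u, hu⟩ := Int.isUnit_iff_natAbs_eq.mpr hone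
    exact ⟨(i, u), (hz u hu.symm).symm⟩
  · rintro ⟨⟨i, u⟩, rfl⟩
    rw [latAdj, Finset.sum_eq_single i]
    · simp [nbr]
    · intro j _ hj
      simp [nbr, hj]
    · simp

lemma latAdj_nbr {d : ℕ} (y : Fin d → ℤ) (p : Fin d × ℤˣ) : latAdj (nbr y p) y :=
  (latAdj_iff_mem_range_nbr _ _).mpr ⟨p, rfl⟩

lemma latAdj_comm {d : ℕ} (x y : Fin d → ℤ) : latAdj x y ↔ latAdj y x := by
  have : ∀ i, (x i - y i).natAbs = (y i - x i).natAbs := fun i => by omega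
  simp only [latAdj, this]

lemma cU_comm (d m : ℕ) (x y : Fin d → ℤ) : cU d m x y = cU d m y x := by
  simp only [cU, latAdj_comm x y]
  congr 1
  exact propext ⟨fun ⟨a, b, c⟩ => ⟨b, a, c⟩, fun ⟨a, b, c⟩ => ⟨b, a, c⟩⟩

lemma tsum_mul_cU {d : ℕ} {y : Fin d → ℤ} (hy : memU d y) (f : (Fin d → ℤ) → ℝ≥0∞) :
    ∑' z, f z * cU d d z y = ∑ p, if memU d (nbr y p) then f (nbr y p) else 0 := by
  rw [← tsum_fintype (L := .unconditional _),
    ← (nbr_injective y).tsum_eq (f := fun z => f z * cU d d z y)]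
  · refine tsum_congr fun p => ?_
    simp [cU, hy, latAdj_nbr]
  · intro z hz
    rw [← latAdj_iff_mem_range_nbr]
    by_contra hadj
    simp [cU, hadj] at hz

/-- The number of lattice neighbours of `y` lying outside the orthant. -/
def outDeg {d : ℕ} (y : Fin d → ℤ) : ℝ≥0∞ := ∑ p, if memU d (nbr y p) then 0 else 1

lemma piW_add_outDeg {d : ℕ} {y : Fin d → ℤ} (hy : memU d y) :
    piW (cU d d) y + outDeg y = 2 * d := by
  have h : piW (cU d d) y = ∑ p, if memU d (nbr y p) then 1 else 0 := by
    rw [← tsum_mul_cU hy fun _ => 1]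
    simp only [piW, one_mul, cU_comm d d y]
  rw [h, outDeg, ← Finset.sum_add_distrib]
  have : ∀ p, ((if memU d (nbr y p) then 1 else 0) + if memU d (nbr y p) then 0 else 1 : ℝ≥0∞)
      = 1 := fun p => by split_ifs <;> simp
  simp [this, mul_comm]

lemma piW_ne_top {d : ℕ} {y : Fin d → ℤ} (hy : memU d y) : piW (cU d d) y ≠ ∞ := by
  refine ne_top_of_le_ne_top ?_ (le_self_add.trans_eq (piW_add_outDeg hy))
  exact ENNReal.mul_ne_top (by simp) (by simp)

lemma outDeg_ne_top {d : ℕ} {y : Fin d → ℤ} (hy : memU d y) : outDeg y ≠ ∞ := by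
  refine ne_top_of_le_ne_top ?_ (le_add_self.trans_eq (piW_add_outDeg hy))
  exact ENNReal.mul_ne_top (by simp) (by simp)

lemma piW_ne_zero {d : ℕ} [NeZero d] {y : Fin d → ℤ} (hy : memU d y) : piW (cU d d) y ≠ 0 := by
  have hmem : memU d (nbr y (0, 1)) := fun j hj => by
    have := hy j hj
    by_cases hj0 : j = 0
    · subst hj0; simp [nbr]; omega
    · simpa [nbr, hj0] using this
  have hadj : latAdj y (nbr y (0, 1)) := (latAdj_comm _ _).mpr (latAdj_nbr y _)
  refine (zero_lt_one.trans_le ?_).ne'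
  calc (1 : ℝ≥0∞) = cU d d y (nbr y (0, 1)) := by simp [cU, hy, hmem, hadj]
    _ ≤ _ := ENNReal.le_tsum _

lemma sum_nbr_eq {d : ℕ} {y : Fin d → ℤ} {f : (Fin d → ℤ) → ℝ≥0∞}
    (hf : ∀ p, ¬ memU d (nbr y p) → f (nbr y p) = f y) :
    ∑ p, f (nbr y p) = (∑ p, if memU d (nbr y p) then f (nbr y p) else 0) + outDeg y * f y := by
  rw [outDeg, Finset.sum_mul, ← Finset.sum_add_distrib]
  refine Finset.sum_congr rfl fun p _ => ?_
  split_ifs with h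
  · simp
  · simp [hf p h]

/-- `specMoment` as an extended nonnegative real. -/
def specMomentE {d : ℕ} (n : ℕ) (y : Fin d → ℤ) : ℝ≥0∞ := ENNReal.ofReal (specMoment n y)

lemma specMomentE_zero {d : ℕ} {y : Fin d → ℤ} (hy : memU d y) :
    specMomentE 0 y = if 0 = y then 1 else 0 := by
  rw [specMomentE, specMoment_zero_of_memU hy]
  split_ifs <;> simp

lemma specMomentE_succ {d : ℕ} [NeZero d] {y : Fin d → ℤ} (hy : memU d y) (n : ℕ) :
    2 * d * specMomentE (n + 1) y
      = (∑ p, if memU d (nbr y p) then specMomentE n (nbr y p) else 0)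
        + outDeg y * specMomentE n y := by
  rw [← sum_nbr_eq fun p hp => ?_]
  · simp only [specMomentE]
    rw [← ENNReal.ofReal_sum_of_nonneg fun p _ => specMoment_nonneg n _, ← specMoment_succ,
      ENNReal.ofReal_mul (by positivity), ENNReal.ofReal_mul (by positivity)]
    simp
  · simp only [specMomentE, specMoment, chebProd_nbr_of_not_memU hy hp]

lemma tsum_specMomentE {d : ℕ} [NeZero d] {y : Fin d → ℤ} (hy : memU d y) :
    2 * d * ∑' n, specMomentE n y
      = 2 * d * (if 0 = y then 1 else 0)
        + (∑ p, if memU d (nbr y p) then ∑' n, specMomentE n (nbr y p) else 0)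
        + outDeg y * ∑' n, specMomentE n y := by
  conv_lhs => rw [tsum_eq_zero_add' ENNReal.summable, mul_add, specMomentE_zero hy,
    ← ENNReal.tsum_mul_left]
  simp only [specMomentE_succ hy]
  rw [ENNReal.tsum_add, ENNReal.tsum_mul_left, add_assoc,
    Summable.tsum_finsetSum fun _ _ => ENNReal.summable]
  congr 3 with p
  split_ifs <;> simp

/-- Comparison of the walk on the orthant with its lazy version, upper bound. -/
lemma sum_stepN_le {d : ℕ} [NeZero d]
    (hfin : ∀ y : Fin d → ℤ, ∑' n, specMomentE n y ≠ ∞) (N : ℕ) {y : Fin d → ℤ} (hy : memU d y) :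
    2 * d * ∑ n ∈ Finset.range N, stepN (cU d d) n 0 y
      ≤ piW (cU d d) y * ∑' n, specMomentE n y := by
  induction N generalizing y with
  | zero => simp
  | succ N ih =>
    refine (ENNReal.add_le_add_iff_right
      (ENNReal.mul_ne_top (outDeg_ne_top hy) (hfin y))).mp ?_
    rw [← add_mul, piW_add_outDeg hy, tsum_specMomentE hy, Finset.sum_range_succ', add_comm _
      (stepN (cU d d) 0 0 y), mul_add]
    gcongr 2 * _ * _ + ?_ + _
    simp only [stepN]
    rw [← Summable.tsum_finsetSum fun _ _ => ENNReal.summable, ← ENNReal.tsum_mul_left,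
      ← tsum_mul_cU hy fun z => ∑' n, specMomentE n z]
    refine ENNReal.tsum_le_tsum fun z => ?_
    rw [← Finset.sum_mul, ← mul_assoc]
    by_cases hz : memU d z
    · calc _ ≤ piW (cU d d) z * (∑' n, specMomentE n z) * step (cU d d) z y := by
            gcongr ?_ * _; exact ih hz
        _ = (∑' n, specMomentE n z) * (piW (cU d d) z * (cU d d z y / piW (cU d d) z)) := by
            rw [step]; ring
        _ ≤ _ := by gcongr; exact ENNReal.mul_div_le
    · have : step (cU d d) z y = 0 := by simp [step, cU, hz]
      simp [this]

lemma two_mul_Gm_le {d : ℕ} [NeZero d]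
    (hfin : ∀ y : Fin d → ℤ, ∑' n, specMomentE n y ≠ ∞) :
    2 * d * Gm d d 0 0 ≤ ∑' n, specMomentE n (0 : Fin d → ℤ) := by
  have h : 2 * d * ∑' n, stepN (cU d d) n 0 0
      ≤ piW (cU d d) 0 * ∑' n, specMomentE n (0 : Fin d → ℤ) := by
    rw [← ENNReal.tsum_mul_left]
    refine ENNReal.tsum_le_of_sum_range_le fun N => ?_
    rw [← Finset.mul_sum]
    exact sum_stepN_le hfin N memU_zero
  rw [Gm, green, mul_left_comm]
  calc _ ≤ (piW (cU d d) 0)⁻¹ * (piW (cU d d) 0 * ∑' n, specMomentE n (0 : Fin d → ℤ)) := by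
        gcongr
    _ = _ := by
        rw [← mul_assoc, ENNReal.inv_mul_cancel (piW_ne_zero memU_zero) (piW_ne_top memU_zero),
          one_mul]

lemma piW_mul_Gm {d : ℕ} [NeZero d] {y : Fin d → ℤ} (hy : memU d y) :
    piW (cU d d) y * Gm d d 0 y
      = (if 0 = y then 1 else 0)
        + ∑ p, if memU d (nbr y p) then Gm d d 0 (nbr y p) else 0 := by
  rw [← tsum_mul_cU hy]
  conv_lhs => rw [Gm, green, ← mul_assoc, ENNReal.mul_inv_cancel (piW_ne_zero hy) (piW_ne_top hy),
    one_mul, tsum_eq_zero_add' ENNReal.summable]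
  simp only [stepN]
  rw [ENNReal.tsum_comm]
  congr 2 with z
  rw [ENNReal.tsum_mul_right, Gm, green, step, div_eq_mul_inv]
  ring

/-- Comparison of the walk on the orthant with its lazy version, lower bound. -/
lemma sum_specMomentE_le {d : ℕ} [NeZero d] (N : ℕ) {y : Fin d → ℤ} (hy : memU d y) :
    ∑ n ∈ Finset.range N, specMomentE n y ≤ 2 * d * Gm d d 0 y := by
  induction N generalizing y with
  | zero => simp
  | succ N ih =>
    have hd0 : (2 * d : ℝ≥0∞) ≠ 0 := by simp [NeZero.ne d]
    have hdt : (2 * d : ℝ≥0∞) ≠ ∞ := ENNReal.mul_ne_top (by simp) (by simp)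
    refine (ENNReal.mul_le_mul_iff_right hd0 hdt).mp ?_
    have hrhs : 2 * d * (2 * d * Gm d d 0 y)
        = 2 * d * (if 0 = y then 1 else 0)
          + ((∑ p, if memU d (nbr y p) then 2 * d * Gm d d 0 (nbr y p) else 0)
          + outDeg y * (2 * d * Gm d d 0 y)) := by
      conv_lhs => rw [← piW_add_outDeg hy, add_mul, mul_left_comm, piW_mul_Gm hy,
        piW_add_outDeg hy]
      simp only [mul_add, Finset.mul_sum, mul_ite, mul_zero, add_assoc]
    rw [hrhs, Finset.sum_range_succ', add_comm _ (specMomentE 0 y), mul_add, specMomentE_zero hy,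
      Finset.mul_sum]
    simp only [specMomentE_succ hy]
    rw [Finset.sum_add_distrib, ← Finset.mul_sum, Finset.sum_comm]
    gcongr with p
    · split_ifs with hp
      · exact ih hp
      · simp
    · exact ih hy

lemma two_mul_Gm_eq {d : ℕ} (hd : 3 ≤ d) :
    2 * d * Gm d d 0 0 = ENNReal.ofReal (∫ θ, (1 - cosAvg θ)⁻¹ ∂anglePi d) := by
  have : NeZero d := ⟨by omega⟩
  have htsum : ∀ y : Fin d → ℤ, ∑' n, specMomentE n y
      = ENNReal.ofReal (∫ θ, chebProd y θ * (1 - cosAvg θ)⁻¹ ∂anglePi d) := fun y => by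
    have h := hasSum_specMoment hd y
    rw [← h.tsum_eq, ENNReal.ofReal_tsum_of_nonneg (fun n => specMoment_nonneg n y) h.summable]
    rfl
  have h0 := htsum 0
  simp only [chebProd_zero, one_mul] at h0
  rw [← h0]
  exact le_antisymm (two_mul_Gm_le fun y => by simp [htsum y])
    (ENNReal.tsum_le_of_sum_range_le fun N => sum_specMomentE_le N memU_zero)


lemma two_div_sub_div_sq_le_inv {m w : ℝ} (hm : 0 < m) (hw : 0 < w) :
    2 / m - w / m ^ 2 ≤ w⁻¹ := by
  have : w⁻¹ - (2 / m - w / m ^ 2) = (w - m) ^ 2 / (m ^ 2 * w) := by field_simp; ring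
  linarith [div_nonneg (sq_nonneg (w - m)) (by positivity : 0 ≤ m ^ 2 * w)]

lemma eq_of_inv_eq_two_div_sub_div_sq {m w : ℝ} (hm : 0 < m) (hw : 0 < w)
    (h : 2 / m - w / m ^ 2 = w⁻¹) : w = m := by
  field_simp at h
  nlinarith [sq_nonneg (w - m)]

lemma sum_cosAvg_removeNth {d : ℕ} [NeZero d] (θ : Fin (d + 1) → ℝ) :
    ∑ j : Fin (d + 1), (1 - cosAvg (j.removeNth θ)) = (d + 1) * (1 - cosAvg θ) := by
  have hd : (d : ℝ) ≠ 0 := by exact_mod_cast NeZero.ne d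
  have h : ∀ j : Fin (d + 1), cosAvg (j.removeNth θ) = (∑ i, cos (θ i) - cos (θ j)) / d := by
    intro j
    rw [cosAvg, Fin.sum_univ_succAbove (fun i => cos (θ i)) j]
    simp [Fin.removeNth]
  simp only [h, Finset.sum_sub_distrib, ← Finset.sum_div]
  rw [cosAvg]
  simp
  field_simp
  ring

lemma measurePreserving_removeNth {d : ℕ} (j : Fin (d + 1)) :
    MeasurePreserving (fun θ : Fin (d + 1) → ℝ => j.removeNth θ) (anglePi (d + 1)) (anglePi d) :=
  (measurePreserving_snd (μ := angleMeasure) (ν := anglePi d)).comp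
    (measurePreserving_piFinSuccAbove (fun _ => angleMeasure) j)

lemma cosAvg_removeNth_lt_one {d : ℕ} [NeZero d] {θ : Fin (d + 1) → ℝ} (h : ∀ i, |cos (θ i)| < 1)
    (j : Fin (d + 1)) : 0 < 1 - cosAvg (j.removeNth θ) := by
  linarith [(abs_lt.mp (abs_cosAvg_lt_one (θ := j.removeNth θ) fun i => h _)).2]

lemma chebProd_single {d : ℕ} (i : Fin d) (k : ℤ) (θ : Fin d → ℝ) :
    chebProd (Pi.single i k) θ = chebV k (θ i) := by
  rw [Pi.single, chebProd_update]
  simp [chebV_zero]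

lemma chebProd_single_update {d : ℕ} {i j : Fin d} (hij : i ≠ j) (k l : ℤ) (θ : Fin d → ℝ) :
    chebProd (Function.update (Pi.single i k) j l) θ = chebV k (θ i) * chebV l (θ j) := by
  have h : Function.update (Pi.single i k) j 0 = (Pi.single i k : Fin d → ℤ) := by
    rw [Function.update_eq_self_iff]; simp [hij.symm]
  have h' := chebProd_update (Pi.single i k) j 0 θ
  rw [h, chebProd_single, chebV_zero, one_mul] at h'
  rw [chebProd_update, ← h', mul_comm]

lemma chebV_one_sq (θ : ℝ) : chebV 1 θ * chebV 1 θ = chebV 2 θ - chebV 1 θ + 1 := by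
  have h0 := chebV_add_one_add_sub_one 0 θ
  have h1 := chebV_add_one_add_sub_one 1 θ
  norm_num [chebV_zero, chebV_neg_one] at h0 h1
  linear_combination -h1 + chebV 1 θ * h0

lemma not_ae_cos_eq {d : ℕ} {i j : Fin d} (hij : i ≠ j) :
    ¬ ∀ᵐ θ ∂anglePi d, cos (θ i) = cos (θ j) := by
  intro h
  have hint : ∀ y : Fin d → ℤ, Integrable (chebProd y) (anglePi d) := fun y => by
    simpa using integrable_chebProd_mul_cosAvg_pow 0 y
  have hmom : ∀ y : Fin d → ℤ, memU d y → ∫ θ, chebProd y θ ∂anglePi d = if 0 = y then 1 else 0 :=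
    fun y hy => by simpa [specMoment] using specMoment_zero_of_memU hy
  have hsingle : ∀ k : ℤ, 0 < k → ∫ θ, chebProd (Pi.single i k) θ ∂anglePi d = 0 := fun k hk => by
    rw [hmom, if_neg]
    · intro h0
      have := congrFun h0 i
      simp at this; omega
    · intro l _
      by_cases hl : l = i
      · subst hl; simpa using hk.le
      · simp [hl]
  have hpair : ∫ θ, chebProd (Function.update (Pi.single i 1) j 1) θ ∂anglePi d = 0 := by
    rw [hmom, if_neg]
    · intro h0
      simpa using congrFun h0 j
    · intro l _
      by_cases hl : l = j
      · subst hl; simp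
      · by_cases hli : l = i
        · subst hli; simp [hl]
        · simp [hl, hli]
  have hsub : Integrable (fun θ => chebProd (Pi.single i 2) θ - chebProd (Pi.single i 1) θ)
      (anglePi d) := (hint _).sub (hint _)
  have hcongr : ∫ θ, chebProd (Function.update (Pi.single i 1) j 1) θ ∂anglePi d
      = ∫ θ, chebProd (Pi.single i 2) θ - chebProd (Pi.single i 1) θ + 1 ∂anglePi d := by
    refine integral_congr_ae ?_
    filter_upwards [h] with θ hθ
    have : chebV 1 (θ j) = chebV 1 (θ i) := by simp only [chebV, hθ]
    rw [chebProd_single_update hij, this, chebProd_single, chebProd_single, chebV_one_sq]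
  rw [hpair, integral_add hsub (integrable_const 1), integral_sub (hint _) (hint _),
    hsingle 2 (by norm_num), hsingle 1 (by norm_num)] at hcongr
  simp at hcongr

lemma integral_inv_one_sub_cosAvg_succ_lt {d : ℕ} (hd : 3 ≤ d) :
    ∫ θ, (1 - cosAvg θ)⁻¹ ∂anglePi (d + 1) < ∫ θ, (1 - cosAvg θ)⁻¹ ∂anglePi d := by
  have : NeZero d := ⟨by omega⟩
  have hd1 : (0 : ℝ) < d + 1 := by positivity
  let G : (Fin (d + 1) → ℝ) → ℝ := fun θ => 
    (∑ j : Fin (d + 1), (1 - cosAvg (j.removeNth θ))⁻¹) / (d + 1)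
  have hcomp : ∀ j : Fin (d + 1),
      Integrable (fun θ : Fin (d + 1) → ℝ => (1 - cosAvg (j.removeNth θ))⁻¹) (anglePi (d + 1)) :=
    fun j => (measurePreserving_removeNth j).integrable_comp_of_integrable
      (integrable_inv_one_sub_cosAvg hd)
  have hG : Integrable G (anglePi (d + 1)) :=
    (integrable_finsetSum _ fun j _ => hcomp j).div_const _
  have hGint : ∫ θ, G θ ∂anglePi (d + 1) = ∫ θ, (1 - cosAvg θ)⁻¹ ∂anglePi d := by
    have hj : ∀ j : Fin (d + 1), ∫ θ, (1 - cosAvg (j.removeNth θ))⁻¹ ∂anglePi (d + 1)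
        = ∫ θ, (1 - cosAvg θ)⁻¹ ∂anglePi d := fun j => by
      rw [← (measurePreserving_removeNth j).map_eq, integral_map
        (measurePreserving_removeNth j).measurable.aemeasurable
        (Measurable.aestronglyMeasurable (by fun_prop))]
    simp only [G]
    rw [integral_div, integral_finsetSum _ fun j _ => hcomp j]
    simp only [hj]
    simp
    field_simp
  have htangent : ∀ θ : Fin (d + 1) → ℝ, (∀ i, |cos (θ i)| < 1) →
      (1 - cosAvg θ)⁻¹ = (∑ j : Fin (d + 1), (2 / (1 - cosAvg θ)
        - (1 - cosAvg (j.removeNth θ)) / (1 - cosAvg θ) ^ 2)) / (d + 1) := by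
    intro θ hθ
    have hpos : 0 < 1 - cosAvg θ := by linarith [(abs_lt.mp (abs_cosAvg_lt_one hθ)).2]
    rw [Finset.sum_sub_distrib, ← Finset.sum_div, ← Finset.sum_div,
      sum_cosAvg_removeNth]
    simp
    field_simp
    ring
  have hle : (fun θ : Fin (d + 1) → ℝ => (1 - cosAvg θ)⁻¹) ≤ᵐ[anglePi (d + 1)] G := by
    filter_upwards [ae_anglePi_abs_cos_lt_one (d + 1)] with θ hθ
    have hpos : 0 < 1 - cosAvg θ := by linarith [(abs_lt.mp (abs_cosAvg_lt_one hθ)).2]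
    rw [htangent θ hθ]
    simp only [G]
    gcongr with j
    exact two_div_sub_div_sq_le_inv hpos (cosAvg_removeNth_lt_one hθ j)
  have hint := integrable_inv_one_sub_cosAvg (d := d + 1) (by omega)
  rw [← hGint]
  refine lt_of_le_of_ne (integral_mono_ae hint hG hle) fun heq => ?_
  rw [integral_eq_iff_of_ae_le hint hG hle] at heq
  have h01 : (0 : Fin (d + 1)) ≠ Fin.last d := by
    simp [Fin.ext_iff, (NeZero.ne d).symm]
  refine not_ae_cos_eq h01 ?_
  filter_upwards [ae_anglePi_abs_cos_lt_one (d + 1), heq] with θ hθ hθ'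
  have hpos : 0 < 1 - cosAvg θ := by linarith [(abs_lt.mp (abs_cosAvg_lt_one hθ)).2]
  rw [htangent θ hθ] at hθ'
  simp only [G] at hθ'
  rw [div_left_inj' hd1.ne', Finset.sum_eq_sum_iff_of_le fun j _ =>
    two_div_sub_div_sq_le_inv hpos (cosAvg_removeNth_lt_one hθ j)] at hθ'
  have hall : ∀ j : Fin (d + 1), cosAvg (j.removeNth θ) = cosAvg θ := fun j => by
    linarith [eq_of_inv_eq_two_div_sub_div_sq hpos (cosAvg_removeNth_lt_one hθ j)
      (hθ' j (Finset.mem_univ j))]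
  have hcos : ∀ j : Fin (d + 1), cos (θ j) = ∑ i, cos (θ i) - d * cosAvg θ := fun j => by
    have hdn : (d : ℝ) ≠ 0 := by exact_mod_cast NeZero.ne d
    rw [← hall j, Fin.sum_univ_succAbove (fun i => cos (θ i)) j, cosAvg]
    simp only [Fin.removeNth]
    field_simp
    ring
  rw [hcos, hcos (Fin.last d)]

/-- For `d ≥ 3`, the quantity `2d · G_O^{(d)}(0,0)` is decreasing in the dimension `d`,
where `G_O^{(d)} = G_d` is the Green's function of the simple random walk on the
`d`-dimensional discrete orthant `O = ℕ₀^d`. -/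
theorem orthant_green_origin_decreasing (d d' : ℕ) (hd : 3 ≤ d) (hdd' : d < d') :
    (2 * (d' : ℝ≥0∞)) * Gm d' d' 0 0 < (2 * (d : ℝ≥0∞)) * Gm d d 0 0 := by
  have hstep : ∀ n, 3 ≤ n →
      (2 * ((n + 1 : ℕ) : ℝ≥0∞)) * Gm (n + 1) (n + 1) 0 0 < (2 * (n : ℝ≥0∞)) * Gm n n 0 0 := by
    intro n hn
    have hlt := integral_inv_one_sub_cosAvg_succ_lt hn
    rw [two_mul_Gm_eq hn, two_mul_Gm_eq (by omega), ENNReal.ofReal_lt_ofReal_iff']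
    refine ⟨hlt, lt_of_le_of_lt (integral_nonneg fun θ => ?_) hlt⟩
    exact inv_nonneg.mpr (by linarith [(abs_le.mp (abs_cosAvg_le_one θ)).2])
  induction d', hdd' using Nat.le_induction with
  | base => exact hstep d hd
  | succ n hn ih => exact (hstep n (by omega)).trans ih

end
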